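/- arXiv:1712.08251 — 3 statements merged into one kernel-verified Lean document; each statement's English description precedes it below -/
import Mathlib

section
/- Let K be a quadratic number field and 𝔞 a nonzero fractional ideal of K whose absolute norm equals 1. Then there exist a nonzero fractional ideal 𝔟 of K and a totally positive element x ∈ K^× such that 𝔞 = x·𝔟². -/
open NumberField

/-- A quadratic field has a conjugation on its ring of integers whose product with the identity
is the norm. -/
lemma exists_ringEquiv_mul_eq_norm (K : Type*) [Field K] [NumberField K]
    (hK : Module.finrank ℚ K = 2) :
    ∃ τ : 𝓞 K ≃+* 𝓞 K, ∀ x, x * τ x = algebraMap ℤ (𝓞 K) (Algebra.norm ℤ x) := by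
  classical
  have : Algebra.IsQuadraticExtension ℚ K := { finrank_eq_two' := hK }
  have hcard : Fintype.card Gal(K/ℚ) = 2 := by
    rw [← Nat.card_eq_fintype_card, IsGalois.card_aut_eq_finrank, hK]
  obtain ⟨σ, hσ, huniv⟩ : ∃ σ : Gal(K/ℚ), (1 : Gal(K/ℚ)) ≠ σ ∧ Finset.univ = {1, σ} := by
    obtain ⟨a, b, hab, hu⟩ := Finset.card_eq_two.mp (Finset.card_univ.trans hcard)
    have h1 : (1 : Gal(K/ℚ)) ∈ ({a, b} : Finset _) := hu ▸ Finset.mem_univ _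
    obtain rfl | rfl : 1 = a ∨ 1 = b := by simpa using h1
    · exact ⟨b, hab, hu⟩
    · exact ⟨a, hab.symm, hu.trans (Finset.pair_comm _ _)⟩
  refine ⟨RingOfIntegers.mapRingEquiv σ.toRingEquiv, fun x ↦ RingOfIntegers.ext ?_⟩
  have h := Algebra.norm_eq_prod_automorphisms ℚ (x : K)
  rw [huniv, Finset.prod_pair hσ, ← Algebra.coe_norm_int] at h
  simpa using h.symm

/-- The product of an ideal with its conjugate is generated by its absolute norm. -/
lemma Ideal.mul_map_eq_span_absNorm {K : Type*} [Field K] [NumberField K]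
    (hK : Module.finrank ℚ K = 2) {τ : 𝓞 K ≃+* 𝓞 K}
    (hτ : ∀ x, x * τ x = algebraMap ℤ (𝓞 K) (Algebra.norm ℤ x)) (I : Ideal (𝓞 K)) :
    I * I.map τ = Ideal.span {(Ideal.absNorm I : 𝓞 K)} := by
  obtain rfl | hI := eq_or_ne I ⊥
  · simp
  have hmem : (Ideal.absNorm I : 𝓞 K) ∈ I * I.map τ := by
    have hle : Ideal.relNorm ℤ I ≤ (I * I.map τ).comap (algebraMap ℤ (𝓞 K)) := by
      rw [Ideal.relNorm_apply, Ideal.span_le]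
      rintro _ ⟨x, hx, rfl⟩
      rw [SetLike.mem_coe, Ideal.mem_comap, Algebra.intNorm_eq_norm, ← hτ]
      exact Ideal.mul_mem_mul hx (Ideal.mem_map_of_mem τ hx)
    have hN : (Ideal.absNorm I : ℤ) ∈ Ideal.relNorm ℤ I := by
      rw [Ideal.relNorm_int]
      exact Ideal.mem_span_singleton_self _
    have := hle hN
    simpa using this
  have hmap : Ideal.absNorm (I.map τ) = Ideal.absNorm I := by
    have h := Ideal.relNorm_map_algEquiv (R := ℤ) (AlgEquiv.ofRingEquiv (f := τ) (by simp)) I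
    have h' := congrArg Ideal.absNorm h
    rw [Ideal.absNorm_relNorm, Ideal.absNorm_relNorm] at h'
    exact h'
  obtain ⟨J, hJ⟩ := Ideal.dvd_iff_le.mpr ((Ideal.span_singleton_le_iff_mem _).mpr hmem)
  have hnorm := congrArg Ideal.absNorm hJ
  rw [map_mul, map_mul, hmap, Ideal.absNorm_span_natCast, RingOfIntegers.rank, hK, sq] at hnorm
  have hJ1 : Ideal.absNorm J = 1 := by
    have : Ideal.absNorm I ≠ 0 := by rwa [Ne, Ideal.absNorm_eq_zero_iff]
    exact Nat.eq_of_mul_eq_mul_left (by positivity) (hnorm.symm.trans (mul_one _).symm)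
  rw [hJ, Ideal.absNorm_eq_one_iff.mp hJ1, Ideal.mul_top]

/-- If `I` has the same norm as the principal ideal `(d)` in a quadratic field, then, up to
positive integers, `I * (d)` is the square of the ideal `(d) + I`. -/
lemma Ideal.mul_span_eq_sq_of_absNorm_eq {K : Type*} [Field K] [NumberField K]
    (hK : Module.finrank ℚ K = 2) {I D : Ideal (𝓞 K)}
    (hI : Ideal.absNorm I = Ideal.absNorm D) :
    I * D * Ideal.span {(Ideal.absNorm (D + I) : 𝓞 K)} =
      Ideal.span {(Ideal.absNorm D : 𝓞 K)} * (D + I) ^ 2 := by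
  obtain ⟨τ, hτ⟩ := exists_ringEquiv_mul_eq_norm K hK
  have hII := Ideal.mul_map_eq_span_absNorm hK hτ I
  have hDD := Ideal.mul_map_eq_span_absNorm hK hτ D
  have hCC := Ideal.mul_map_eq_span_absNorm hK hτ (D + I)
  have hsum : (D + I).map τ = D.map τ + I.map τ := Ideal.map_sup _ _ _
  rw [hI, ← hDD] at hII
  have hconj : I * (D + I).map τ = (D + I) * D.map τ := by
    rw [hsum, mul_add, hII, add_mul, add_comm]
  rw [← hCC, ← hDD]
  calc I * D * ((D + I) * (D + I).map τ) = D * (D + I) * (I * (D + I).map τ) := by ring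
    _ = _ := by rw [hconj]; ring

/-- Let `K` be a quadratic number field and `𝔞` a nonzero fractional ideal
of `K` of absolute norm `1`.  Then `𝔞 = x·𝔟²` for some nonzero fractional ideal `𝔟` and some
totally positive `x ∈ K˟`. -/
theorem stmt_1 (K : Type) [Field K] [NumberField K] (hK : Module.finrank ℚ K = 2)
    (𝔞 : FractionalIdeal (nonZeroDivisors (𝓞 K)) K) (h𝔞 : 𝔞 ≠ 0)
    (hN : FractionalIdeal.absNorm 𝔞 = 1) :
    ∃ (𝔟 : FractionalIdeal (nonZeroDivisors (𝓞 K)) K) (x : K),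
      𝔟 ≠ 0 ∧ x ≠ 0 ∧ (∀ τ : K →+* ℝ, 0 < τ x) ∧
      𝔞 = FractionalIdeal.spanSingleton (nonZeroDivisors (𝓞 K)) x * 𝔟 ^ 2 := by
  set d : 𝓞 K := (𝔞.den : 𝓞 K) with hd
  have hd0 : d ≠ 0 := nonZeroDivisors.coe_ne_zero _
  set D : Ideal (𝓞 K) := Ideal.span {d} with hD
  have hD0 : D ≠ ⊥ := by simpa [hD] using hd0
  have hI : Ideal.absNorm 𝔞.num = Ideal.absNorm D := by
    have hne : (|Algebra.norm ℤ d| : ℚ) ≠ 0 := by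
      simpa [Algebra.norm_eq_zero_iff] using hd0
    rw [FractionalIdeal.absNorm_eq, ← hd, Int.cast_abs, div_eq_one_iff_eq hne] at hN
    rw [hD, Ideal.absNorm_span_singleton]
    have : (Ideal.absNorm 𝔞.num : ℤ) = |Algebra.norm ℤ d| := by exact_mod_cast hN
    rw [← Int.natCast_inj, this, Int.natCast_natAbs]
  have key := Ideal.mul_span_eq_sq_of_absNorm_eq hK hI
  set C := D + 𝔞.num with hC
  have hC0 : C ≠ ⊥ := fun h ↦ hD0 (le_bot_iff.mp (h ▸ le_sup_left))
  have hm : Ideal.absNorm C ≠ 0 := by rwa [Ne, Ideal.absNorm_eq_zero_iff]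
  have hn : Ideal.absNorm D ≠ 0 := by rwa [Ne, Ideal.absNorm_eq_zero_iff]
  set m := Ideal.absNorm C
  set n := Ideal.absNorm D
  have hDf : (D : FractionalIdeal (nonZeroDivisors (𝓞 K)) K) ≠ 0 :=
    FractionalIdeal.coeIdeal_ne_zero.mpr hD0
  have hCf : (C : FractionalIdeal (nonZeroDivisors (𝓞 K)) K) ≠ 0 :=
    FractionalIdeal.coeIdeal_ne_zero.mpr hC0
  have hmK : (m : K) ≠ 0 := by exact_mod_cast hm
  have hnK : (n : K) ≠ 0 := by exact_mod_cast hn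
  refine ⟨C / D, n / m, div_ne_zero hCf hDf, div_ne_zero hnK hmK, fun τ ↦ ?_, ?_⟩
  · rw [map_div₀, map_natCast, map_natCast]
    positivity
  have hmf : FractionalIdeal.spanSingleton (nonZeroDivisors (𝓞 K)) (m : K) ≠ 0 :=
    FractionalIdeal.spanSingleton_ne_zero_iff.mpr hmK
  have hnum : (𝔞.num : FractionalIdeal (nonZeroDivisors (𝓞 K)) K) = D * 𝔞 := by
    rw [← FractionalIdeal.den_mul_self_eq_num', hD, FractionalIdeal.coeIdeal_span_singleton]
  have hkey := congrArg
    (fun J : Ideal (𝓞 K) ↦ (J : FractionalIdeal (nonZeroDivisors (𝓞 K)) K)) key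
  simp only [FractionalIdeal.coeIdeal_mul, FractionalIdeal.coeIdeal_pow, hnum,
    FractionalIdeal.coeIdeal_span_singleton, map_natCast] at hkey
  have hdiv : FractionalIdeal.spanSingleton (nonZeroDivisors (𝓞 K)) ((n : K) / m) =
      FractionalIdeal.spanSingleton (nonZeroDivisors (𝓞 K)) (n : K) /
        FractionalIdeal.spanSingleton (nonZeroDivisors (𝓞 K)) (m : K) := by
    rw [eq_div_iff hmf, FractionalIdeal.spanSingleton_mul_spanSingleton, div_mul_cancel₀ _ hmK]
  rw [hdiv, div_pow, div_mul_div_comm, ← hkey, eq_div_iff (mul_ne_zero hmf (pow_ne_zero 2 hDf))]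
  ring
end

section
/- Let K be a number field, d ≥ 1 an integer, h_0, …, h_d ∈ O_K, and f(X, Y) = Σ_{i=0}^{d} h_i X^{d−i} Y^i the associated homogeneous binary form of degree d. If k belongs to the ideal (h_0, …, h_d) of O_K generated by the coefficients, then there exist a finite field extension L of K and elements x, y ∈ O_L such that f(x, y) = k. -/
open NumberField
open Polynomial

/-- The value at `(a, b)` of the degree `n` homogenization of `p`. -/
noncomputable def homEval {R : Type*} [CommRing R] (p : R[X]) (n : ℕ) (a b : R) : R :=
  MvPolynomial.eval ![a, b] (p.homogenize n)

section HomEval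

variable {R : Type*} [CommRing R]

theorem homEval_mul {p q : R[X]} {m n : ℕ} (hp : p.natDegree ≤ m) (hq : q.natDegree ≤ n)
    (a b : R) : homEval (p * q) (m + n) a b = homEval p m a b * homEval q n a b := by
  simp [homEval, homogenize_mul p q hp hq]

theorem homEval_one (n : ℕ) (a b : R) : homEval 1 n a b = b ^ n := by
  simp [homEval]

theorem homEval_sub (p q : R[X]) (n : ℕ) (a b : R) :
    homEval (p - q) n a b = homEval p n a b - homEval q n a b := by
  simp [homEval]

theorem homEval_C_mul (c : R) (p : R[X]) (n : ℕ) (a b : R) :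
    homEval (C c * p) n a b = c * homEval p n a b := by
  simp [homEval]

theorem homEval_pow {p : R[X]} {n : ℕ} (hp : p.natDegree ≤ n) (k : ℕ) (a b : R) :
    homEval (p ^ k) (k * n) a b = homEval p n a b ^ k := by
  induction k with
  | zero => simp [homEval_one]
  | succ k ih =>
    rw [pow_succ, pow_succ, add_mul, one_mul, homEval_mul (natDegree_pow_le_of_le k hp) hp, ih]

theorem homEval_prod {ι : Type*} (s : Finset ι) {p : ι → R[X]} (hp : ∀ i ∈ s, (p i).natDegree ≤ 1)
    (a b : R) : homEval (∏ i ∈ s, p i) s.card a b = ∏ i ∈ s, homEval (p i) 1 a b := by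
  have := homogenize_finsetProd hp
  simp only [Finset.sum_const, smul_eq_mul, mul_one] at this
  simp [homEval, this, map_prod]

theorem homEval_linear (u v a b : R) : homEval (C u * X + C v) 1 a b = u * a + v * b := by
  simp [homEval, homogenize_X]

theorem homEval_eq_sum (p : R[X]) (n : ℕ) (a b : R) :
    homEval p n a b = ∑ i ∈ Finset.range (n + 1), p.coeff i * a ^ i * b ^ (n - i) := by
  simp only [homEval, homogenize, Finset.Nat.sum_antidiagonal_eq_sum_range_succ_mk,
    MvPolynomial.eval_sum]
  refine Finset.sum_congr rfl fun k _ => ?_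
  rw [MvPolynomial.eval_monomial, Finsupp.update_eq_add_single, Finsupp.prod_add_index',
    Finsupp.prod_single_index, Finsupp.prod_single_index]
  · simp [mul_assoc]
  all_goals simp [pow_add]

theorem homEval_smul (p : R[X]) (n : ℕ) (c a b : R) :
    homEval p n (c * a) (c * b) = c ^ n * homEval p n a b := by
  simp only [homEval_eq_sum, Finset.mul_sum]
  refine Finset.sum_congr rfl fun i hi => ?_
  have h : c ^ n = c ^ i * c ^ (n - i) := by rw [← pow_add, Nat.add_sub_cancel' (by grind)]
  rw [h]
  ring

theorem map_homEval {S : Type*} [CommRing S] (f : R →+* S) (p : R[X]) (n : ℕ) (a b : R) :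
    f (homEval p n a b) = homEval (p.map f) n (f a) (f b) := by
  simp [homEval_eq_sum]

theorem homEval_zero_right (p : R[X]) (n : ℕ) (a : R) :
    homEval p n a 0 = p.coeff n * a ^ n := by
  rw [homEval_eq_sum, Finset.sum_range_succ, Finset.sum_eq_zero]
  · simp
  · intro i hi
    rw [zero_pow (by grind), mul_zero]

theorem isCoprime_iff_isUnit_mk {x y : R} :
    IsCoprime x y ↔ IsUnit (Ideal.Quotient.mk (Ideal.span {y}) x) := by
  rw [isUnit_iff_exists_inv, (Ideal.Quotient.mk_surjective).exists]
  simp_rw [← map_mul, ← map_one (Ideal.Quotient.mk (Ideal.span {y})),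
    Ideal.Quotient.mk_eq_mk_iff_sub_mem, Ideal.mem_span_singleton]
  constructor
  · rintro ⟨c, d, h⟩
    exact ⟨c, -d, by linear_combination h⟩
  · rintro ⟨c, d, h⟩
    exact ⟨c, -d, by linear_combination h⟩

theorem isCoprime_homEval_right {m : R[X]} (hm : m.Monic) {a b : R} (h : IsCoprime a b) :
    IsCoprime (homEval m m.natDegree a b) b := by
  have h0 : Ideal.Quotient.mk (Ideal.span {b}) b = 0 := by simp
  rw [isCoprime_iff_isUnit_mk, map_homEval, h0, homEval_zero_right, coeff_map,
    hm.coeff_natDegree, map_one, one_mul]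
  exact (isCoprime_iff_isUnit_mk.1 h).pow _

/-- If the form attached to `p` is invertible at a unimodular pair `(a', b')`, then its value at any
other unimodular pair `(a, b)` is coprime to the determinant of the two pairs. -/
theorem isCoprime_homEval_det (p : R[X]) (n : ℕ) {a b a' b' : R} (h : IsCoprime a b)
    (h' : IsCoprime a' b') (hu : IsUnit (homEval p n a' b')) :
    IsCoprime (homEval p n a b) (b' * a - a' * b) := by
  rw [isCoprime_iff_isUnit_mk, map_homEval]
  set f := Ideal.Quotient.mk (Ideal.span {b' * a - a' * b}) with hf
  have hd : f b' * f a - f a' * f b = 0 := by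
    simp only [← map_mul, ← map_sub]
    simp [hf]
  obtain ⟨u, v, e⟩ := h
  obtain ⟨u', v', e'⟩ := h'
  replace e := congrArg f e
  replace e' := congrArg f e'
  simp only [map_add, map_mul, map_one] at e e'
  have ha : f a = (f u' * f a + f v' * f b) * f a' := by
    linear_combination (-f a) * e' + f v' * hd
  have hb : f b = (f u' * f a + f v' * f b) * f b' := by
    linear_combination (-f b) * e' - f u' * hd
  have hw : IsUnit (f u' * f a + f v' * f b) :=
    .of_mul_eq_one (f u * f a' + f v * f b') (by linear_combination e - f u * ha - f v * hb)
  generalize f u' * f a + f v' * f b = w at ha hb hw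
  rw [ha, hb, homEval_smul, ← map_homEval]
  exact (hw.pow n).mul (hu.map f)

end HomEval

/-- Skolem's theorem for a product of linear forms: over a domain in which every element is of
finite order modulo any nonzero element coprime to it, some monic polynomial has invertible
homogeneous value at finitely many given pairwise distinct unimodular pairs. -/
theorem exists_monic_isUnit_homEval {R : Type*} [CommRing R] [IsDomain R]
    (H : ∀ x D : R, D ≠ 0 → IsCoprime x D → ∃ k, 0 < k ∧ D ∣ x ^ k - 1)
    {ι : Type*} (s : Finset ι) (a b : ι → R) (hab : ∀ i ∈ s, IsCoprime (a i) (b i))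
    (hb : ∀ i ∈ s, b i ≠ 0) (hne : ∀ i ∈ s, ∀ j ∈ s, i ≠ j → b i * a j - a i * b j ≠ 0) :
    ∃ m : R[X], m.Monic ∧ 0 < m.natDegree ∧
      ∀ i ∈ s, IsUnit (homEval m m.natDegree (a i) (b i)) := by
  classical
  induction s using Finset.induction_on with
  | empty => exact ⟨X, monic_X, by simp, by simp⟩
  | insert j s hj ih =>
    obtain ⟨m, hm, hn, hu⟩ := ih (fun i hi => hab i (by simp [hi])) (fun i hi => hb i (by simp [hi]))
      (fun i hi k hk => hne i (by simp [hi]) k (by simp [hk]))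
    have hj' := hab j (by simp)
    obtain ⟨u, v, huv⟩ := id hj'
    set D := (∏ i ∈ s, (b i * a j - a i * b j)) * b j with hD
    have hD0 : D ≠ 0 := mul_ne_zero (Finset.prod_ne_zero_iff.2 fun i hi =>
      hne i (by simp [hi]) j (by simp) (by rintro rfl; exact hj hi)) (hb j (by simp))
    have hcop : IsCoprime (homEval m m.natDegree (a j) (b j)) D :=
      (IsCoprime.prod_right fun i hi => isCoprime_homEval_det m _ hj'
        (hab i (by simp [hi])) (hu i hi)).mul_right (isCoprime_homEval_right hm hj')
    obtain ⟨k, hk, hdvd⟩ := H _ _ hD0 hcop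
    obtain ⟨q, hq⟩ := hdvd.trans (sub_one_dvd_pow_sub_one _ (s.card + 1))
    rw [← pow_mul] at hq
    obtain ⟨e, he⟩ : ∃ e, k * (s.card + 1) * m.natDegree = s.card + 1 + e :=
      Nat.exists_eq_add_of_le (by nlinarith [Nat.mul_pos hk hn])
    set G : R[X] := ∏ i ∈ s, (C (b i) * X + C (-a i)) with hG
    have hGd : G.natDegree ≤ s.card := by
      refine (natDegree_prod_le _ _).trans ((Finset.sum_le_card_nsmul _ _ 1 fun i _ => ?_).trans
        (by simp))
      exact natDegree_linear_le
    set L : R[X] := (C u * X + C v) ^ e with hL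
    have hLd : L.natDegree ≤ e :=
      (natDegree_pow_le_of_le e natDegree_linear_le).trans (mul_one e).le
    have hval : ∀ x y, homEval (m ^ (k * (s.card + 1)) - C q * (G * 1 * L))
        (k * (s.card + 1) * m.natDegree) x y =
        homEval m m.natDegree x y ^ (k * (s.card + 1)) -
          q * ((∏ i ∈ s, (b i * x - a i * y)) * y * (u * x + v * y) ^ e) := by
      intro x y
      rw [homEval_sub, homEval_pow le_rfl, homEval_C_mul, he,
        homEval_mul (natDegree_mul_le_of_le hGd (by simp)) hLd, homEval_mul hGd (by simp),
        homEval_one, pow_one, hG, homEval_prod _ (fun i _ => natDegree_linear_le), hL]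
      conv_lhs => enter [2, 2, 2, 2]; rw [← mul_one e]
      rw [homEval_pow natDegree_linear_le]
      simp only [homEval_linear, neg_mul, ← sub_eq_add_neg]
    have hdeg : (m ^ (k * (s.card + 1))).natDegree = k * (s.card + 1) * m.natDegree := by simp
    have hlt : (C q * (G * 1 * L)).natDegree < (m ^ (k * (s.card + 1))).natDegree := by
      rw [hdeg, he, mul_one]
      have := natDegree_C_mul_le q (G * L)
      have := natDegree_mul_le_of_le hGd hLd
      omega
    have hnd := (natDegree_sub_eq_left_of_natDegree_lt hlt).trans hdeg
    refine ⟨m ^ (k * (s.card + 1)) - C q * (G * 1 * L), (hm.pow _).sub_of_left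
      (degree_lt_degree hlt), by rw [hnd]; positivity, ?_⟩
    rw [hnd]
    intro i hi
    rw [hval]
    rcases Finset.mem_insert.1 hi with rfl | hi
    · rw [huv, one_pow, mul_one, ← hD, mul_comm q, ← hq]
      simp
    · rw [Finset.prod_eq_zero hi (by ring)]
      simpa using (hu i hi).pow _

/-- Affine form of `exists_monic_isUnit_homEval`: finitely many linear polynomials with unimodular
coefficients and distinct roots take invertible values at a common point. -/
theorem exists_forall_isUnit_sub_mul {R : Type*} [CommRing R] [IsDomain R]
    (H : ∀ x D : R, D ≠ 0 → IsCoprime x D → ∃ k, 0 < k ∧ D ∣ x ^ k - 1)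
    (hroot : ∀ p : R[X], p.Monic → 0 < p.natDegree → ∃ y, p.IsRoot y)
    {ι : Type*} (s : Finset ι) (a b : ι → R) (hab : ∀ i ∈ s, IsCoprime (a i) (b i))
    (hb : ∀ i ∈ s, b i ≠ 0) (hne : ∀ i ∈ s, ∀ j ∈ s, i ≠ j → b i * a j - a i * b j ≠ 0) :
    ∃ y : R, ∀ i ∈ s, IsUnit (b i * y - a i) := by
  obtain ⟨m, hm, hn, hu⟩ := exists_monic_isUnit_homEval H s a b hab hb hne
  obtain ⟨y, hy⟩ := hroot m hm hn
  obtain ⟨q, hq⟩ := dvd_iff_isRoot.2 hy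
  refine ⟨y, fun i hi => ?_⟩
  have hq0 : q ≠ 0 := by rintro rfl; simp [hq] at hn
  have h := hu i hi
  rw [hq, natDegree_mul (X_sub_C_ne_zero y) hq0, homEval_mul le_rfl le_rfl, natDegree_X_sub_C] at h
  have h1 := homEval_linear 1 (-y) (a i) (b i)
  rw [map_one, one_mul, map_neg, ← sub_eq_add_neg] at h1
  rw [h1] at h
  convert (isUnit_of_mul_isUnit_left h).neg using 1
  ring

section AlgebraicIntegers

variable {F : Type*} [Field F]

theorem exists_dvd_pow_sub_one (x D : 𝓞 F) (hD : D ≠ 0) (h : IsCoprime x D) :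
    ∃ k, 0 < k ∧ D ∣ x ^ k - 1 := by
  let S := Algebra.adjoin ℤ {x, D}
  have : Module.Finite ℤ S := by
    refine Module.Finite.iff_fg.2 (fg_adjoin_of_finite (by simp) fun y _ => ?_)
    exact Algebra.IsIntegral.isIntegral y
  let x' : S := ⟨x, Algebra.subset_adjoin (by simp)⟩
  let D' : S := ⟨D, Algebra.subset_adjoin (by simp)⟩
  have hD' : D' ≠ 0 := fun h => hD (congrArg Subtype.val h)
  have : Finite (S ⧸ Ideal.span {D'}) :=
    Ring.HasFiniteQuotients.finiteQuotient (by simpa using hD')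
  obtain ⟨i, j, hij, e⟩ := Finite.exists_ne_map_eq_of_infinite
    fun i : ℕ => Ideal.Quotient.mk (Ideal.span {D'}) (x' ^ i)
  wlog hlt : i < j generalizing i j
  · exact this j i hij.symm e.symm (by omega)
  refine ⟨j - i, by omega, ?_⟩
  have hd := Ideal.mem_span_singleton.1 (Ideal.Quotient.eq.1 e.symm)
  have hd2 : D ∣ x ^ j - x ^ i := map_dvd S.val hd
  refine (h.symm.pow_right (n := i)).dvd_of_dvd_mul_left ?_
  rwa [mul_sub, ← pow_add, mul_one, Nat.add_sub_cancel' hlt.le]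

theorem exists_isRoot_of_monic [IsAlgClosed F] (p : (𝓞 F)[X]) (hp : p.Monic)
    (hn : 0 < p.natDegree) : ∃ y, p.IsRoot y := by
  obtain ⟨z, hz⟩ := IsAlgClosed.exists_eval₂_eq_zero_of_injective (algebraMap (𝓞 F) F)
    RingOfIntegers.coe_injective p (natDegree_pos_iff_degree_pos.1 hn).ne'
  have hzi : IsIntegral (𝓞 F) z := ⟨p, hp, hz⟩
  obtain ⟨y, rfl⟩ : ∃ y : 𝓞 F, (y : F) = z := ⟨⟨z, isIntegral_trans z hzi⟩, rfl⟩
  refine ⟨y, RingOfIntegers.coe_injective ?_⟩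
  rw [map_zero, ← hz, eval₂_at_apply]

theorem exists_pow_eq_of_isAlgClosed [IsAlgClosed F] (x : 𝓞 F) {n : ℕ} (hn : n ≠ 0) :
    ∃ y : 𝓞 F, y ^ n = x := by
  obtain ⟨y, hy⟩ := exists_isRoot_of_monic (X ^ n - C x) (monic_X_pow_sub_C x hn)
    (by rw [natDegree_X_pow_sub_C]; omega)
  exact ⟨y, by simpa [sub_eq_zero] using hy⟩

theorem dvd_of_pow_dvd_pow {x y : 𝓞 F} {n : ℕ} (hn : n ≠ 0) (hx : x ≠ 0) (h : x ^ n ∣ y ^ n) :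
    x ∣ y := by
  obtain ⟨w, hw⟩ := h
  have hxF : (x : F) ≠ 0 := (map_ne_zero_iff _ RingOfIntegers.coe_injective).2 hx
  have hwF : (y / x : F) ^ n = w := by
    rw [div_pow, div_eq_iff (pow_ne_zero n hxF), mul_comm, ← map_pow, ← map_pow, hw, map_mul]
  obtain ⟨z, hz⟩ : ∃ z : 𝓞 F, (z : F) = y / x :=
    ⟨⟨_, IsIntegral.of_pow (Nat.pos_of_ne_zero hn) (hwF ▸ w.2)⟩, rfl⟩
  refine ⟨z, RingOfIntegers.coe_injective ?_⟩
  rw [map_mul]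
  exact (mul_div_cancel₀ _ hxF).symm.trans (congrArg _ hz.symm)

/-- Every algebraic number is a quotient of two coprime algebraic integers. -/
theorem exists_isCoprime_mul_eq [IsAlgClosed F] [CharZero F] [Algebra.IsAlgebraic ℚ F] (z : F) :
    ∃ a b : 𝓞 F, IsCoprime a b ∧ b ≠ 0 ∧ (b : F) * z = a := by
  let L := IntermediateField.adjoin ℚ {z}
  have : FiniteDimensional ℚ L :=
    IntermediateField.adjoin.finiteDimensional (Algebra.IsIntegral.isIntegral z)
  have : NumberField L := ⟨⟩
  let z' : L := ⟨z, IntermediateField.mem_adjoin_simple_self ℚ z⟩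
  obtain ⟨p, q, hq, hz⟩ := IsFractionRing.div_surjective (A := 𝓞 L) z'
  have hq0 : q ≠ 0 := nonZeroDivisors.ne_zero hq
  let I : nonZeroDivisors (Ideal (𝓞 L)) := ⟨Ideal.span {p, q}, by
    rw [mem_nonZeroDivisors_iff_ne_zero]
    intro h
    apply hq0
    have : q ∈ Ideal.span {p, q} := Ideal.subset_span (by simp)
    rw [h] at this
    simpa using this⟩
  have h1 : ClassGroup.mk0 (I ^ Fintype.card (ClassGroup (𝓞 L))) = 1 := by
    rw [map_pow, pow_card_eq_one]
  obtain ⟨n, hn, h1⟩ : ∃ n ≠ 0, ClassGroup.mk0 (I ^ n) = 1 := ⟨_, Fintype.card_ne_zero, h1⟩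
  rw [ClassGroup.mk0_eq_one_iff] at h1
  obtain ⟨c, hc⟩ := h1
  replace hc : (Ideal.span {p, q}) ^ n = Ideal.span {c} := hc
  let φ := algebraMap (𝓞 L) (𝓞 F)
  have hφ : Function.Injective φ := FaithfulSMul.algebraMap_injective _ _
  obtain ⟨g, hg⟩ := exists_pow_eq_of_isAlgClosed (φ c) hn
  have hc0 : c ≠ 0 := by
    rintro rfl
    exact nonZeroDivisors.ne_zero (I ^ n).2 (hc.trans (by simp))
  have hg0 : g ≠ 0 := by
    rintro rfl
    rw [zero_pow hn] at hg
    exact hc0 ((map_eq_zero_iff φ hφ).1 hg.symm)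
  have hdvd : ∀ r ∈ Ideal.span {p, q}, g ∣ φ r := by
    intro r hr
    refine dvd_of_pow_dvd_pow hn hg0 ?_
    rw [hg, ← map_pow]
    exact map_dvd φ (Ideal.mem_span_singleton.1 (hc ▸ Ideal.pow_mem_pow hr n))
  obtain ⟨a, ha⟩ := hdvd p (Ideal.subset_span (by simp))
  obtain ⟨b, hb⟩ := hdvd q (Ideal.subset_span (by simp))
  have hqφ : φ q ≠ 0 := (map_ne_zero_iff φ hφ).2 hq0
  have hb0 : b ≠ 0 := by rintro rfl; simp [hb] at hqφ
  refine ⟨a, b, ?_, hb0, ?_⟩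
  · have h2 : Ideal.span {φ c} = Ideal.span {φ c} * Ideal.span {a, b} ^ n := by
      have := congrArg (Ideal.map φ) hc
      rw [Ideal.map_pow, Ideal.map_span, Ideal.map_span, Set.image_pair, Set.image_singleton,
        ha, hb] at this
      rw [← this]
      conv_rhs => rw [this, ← hg, ← Ideal.span_singleton_pow, ← mul_pow, Ideal.span_mul_span']
      simp [Set.singleton_mul, Set.image_pair]
    have h3 : φ c ∈ Ideal.span {φ c} * Ideal.span {a, b} ^ n := h2 ▸ Ideal.mem_span_singleton_self _
    obtain ⟨w, hw, e⟩ := Ideal.mem_span_singleton_mul.1 h3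
    have hw1 : w = 1 := mul_left_cancel₀ (hg ▸ pow_ne_zero n hg0 : φ c ≠ 0) (by rw [e, mul_one])
    rw [hw1, ← Ideal.eq_top_iff_one, Ideal.pow_eq_top_iff] at hw
    rw [← Ideal.isCoprime_span_singleton_iff, Ideal.isCoprime_iff_sup_eq, ← Ideal.span_insert]
    simpa [hn] using hw
  · have e : (φ q : F) * z = φ p := by
      have : (q : L) * z' = p := by
        rw [← hz, mul_div_cancel₀]
        exact (map_ne_zero_iff _ RingOfIntegers.coe_injective).2 hq0
      exact congrArg (algebraMap L F) this
    rw [ha, hb] at e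
    push_cast at e
    refine mul_left_cancel₀ ((map_ne_zero_iff _ RingOfIntegers.coe_injective).2 hg0) ?_
    rw [← e, mul_assoc]

end AlgebraicIntegers

/-- A polynomial over an algebraic closure of `ℚ` is a constant multiple of a polynomial with
algebraic integer coefficients that takes a unit value at some algebraic integer. -/
theorem exists_eq_C_mul_map_isUnit_eval {F : Type*} [Field F] [IsAlgClosed F] [CharZero F]
    [Algebra.IsAlgebraic ℚ F] (p : F[X]) :
    ∃ (c : F) (P : (𝓞 F)[X]) (y : 𝓞 F),
      p = C c * P.map (algebraMap (𝓞 F) F) ∧ IsUnit (P.eval y) := by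
  classical
  choose a b hab hb hz using exists_isCoprime_mul_eq (F := F)
  have hbF : ∀ z, (b z : F) ≠ 0 := fun z =>
    (map_ne_zero_iff _ RingOfIntegers.coe_injective).2 (hb z)
  obtain ⟨y, hy⟩ := exists_forall_isUnit_sub_mul exists_dvd_pow_sub_one exists_isRoot_of_monic
    p.roots.toFinset a b (fun z _ => hab z) (fun z _ => hb z) fun z _ w _ hzw h => by
      replace h := congrArg (algebraMap (𝓞 F) F) h
      simp only [map_sub, map_mul, map_zero, ← hz] at h
      have : (b z : F) * b w * (w - z) = 0 := by linear_combination h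
      simp [hbF, sub_eq_zero, hzw.symm] at this
  refine ⟨p.leadingCoeff / (p.roots.map fun z => (b z : F)).prod,
    (p.roots.map fun z => C (b z) * X - C (a z)).prod, y, ?_, ?_⟩
  · have h1 : ((p.roots.map fun z => C (b z) * X - C (a z)).prod).map (algebraMap (𝓞 F) F) =
        C (p.roots.map fun z => (b z : F)).prod * (p.roots.map fun z => X - C z).prod := by
      rw [Polynomial.map_multiset_prod, Multiset.map_map, map_multiset_prod, Multiset.map_map,
        ← Multiset.prod_map_mul]
      congr 1
      refine Multiset.map_congr rfl fun z _ => ?_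
      simp [← hz, mul_sub]
    have h0 : (p.roots.map fun z => (b z : F)).prod ≠ 0 := by
      simp [Multiset.prod_eq_zero_iff, hb]
    rw [h1, ← mul_assoc, ← C_mul, div_mul_cancel₀ _ h0]
    exact (IsAlgClosed.splits p).eq_prod_roots
  · rw [eval_multiset_prod, Multiset.map_map]
    refine Multiset.prod_induction IsUnit _ (fun _ _ => IsUnit.mul) isUnit_one fun u hu => ?_
    obtain ⟨z, hzr, rfl⟩ := Multiset.mem_map.1 hu
    simpa using hy z (by simpa using hzr)

/-- Birch. Let `K` be a number field, `d ≥ 1`, `h₀, …, h_d ∈ 𝓞 K` and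
`f(X,Y) = ∑ i, h i * X^(d-i) * Y^i` the associated homogeneous binary form of degree `d`.
If `k` lies in the ideal of `𝓞 K` generated by the coefficients, then there is a finite
extension `L/K` and `x, y ∈ 𝓞 L` with `f(x,y) = k`. -/
theorem stmt_8 (K : Type) [Field K] [NumberField K] (d : ℕ) (hd : 1 ≤ d)
    (h : Fin (d + 1) → 𝓞 K) (k : 𝓞 K) (hk : k ∈ Ideal.span (Set.range h)) :
    ∃ (L : Type) (iF : Field L), letI := iF;
    ∃ (iA : Algebra K L), letI := iA;
    ∃ (_ : FiniteDimensional K L) (iN : NumberField L), letI := iN;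
    ∃ x y : 𝓞 L,
      (∑ i : Fin (d + 1),
          algebraMap (𝓞 K) (𝓞 L) (h i) * x ^ (d - (i : ℕ)) * y ^ (i : ℕ)) =
        algebraMap (𝓞 K) (𝓞 L) k := by
  let F := AlgebraicClosure K
  have : Algebra.IsAlgebraic ℚ F := Algebra.IsAlgebraic.trans ℚ K F
  let f : 𝓞 K →+* F := (algebraMap K F).comp (algebraMap (𝓞 K) K)
  obtain ⟨c, P, y, hP, hu⟩ := exists_eq_C_mul_map_isUnit_eval
    (∑ i : Fin (d + 1), C (f (h i)) * X ^ (i : ℕ))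
  have hcoeff : ∀ j, f (h j) = c * (P.coeff j : F) := by
    intro j
    have := congrArg (fun p => coeff p (j : ℕ)) hP
    simpa [coeff_X_pow, Fin.val_inj] using this
  obtain ⟨s, hs⟩ : ∃ s : 𝓞 F, f k = c * algebraMap (𝓞 F) F s := by
    induction hk using Submodule.span_induction with
    | mem x hx =>
      obtain ⟨j, rfl⟩ := hx
      exact ⟨_, hcoeff j⟩
    | zero => exact ⟨0, by simp⟩
    | add x y _ _ hx hy =>
      obtain ⟨s, hs⟩ := hx
      obtain ⟨t, ht⟩ := hy
      exact ⟨s + t, by rw [map_add f, hs, ht, map_add, mul_add]⟩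
    | smul r x _ hx =>
      obtain ⟨s, hs⟩ := hx
      refine ⟨algebraMap (𝓞 K) (𝓞 F) r * s, ?_⟩
      rw [smul_eq_mul, map_mul f, hs, map_mul, mul_left_comm]
      rfl
  obtain ⟨v, hv⟩ := hu.exists_left_inv
  obtain ⟨t, ht⟩ := exists_pow_eq_of_isAlgClosed (s * v) (by omega : d ≠ 0)
  let L := IntermediateField.adjoin K {(t : F), (y : F)}
  have hfin : FiniteDimensional K L :=
    IntermediateField.finiteDimensional_adjoin fun x _ => Algebra.IsIntegral.isIntegral x
  have hL : NumberField L := NumberField.of_module_finite K L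
  have hlift : ∀ w : 𝓞 F, (w : F) ∈ L → ∃ w' : 𝓞 L, algebraMap L F (w' : L) = w := fun w hw =>
    ⟨⟨⟨w, hw⟩, (isIntegral_algebraMap_iff (algebraMap L F).injective).1 w.2⟩, rfl⟩
  obtain ⟨t', ht'⟩ := hlift t (IntermediateField.subset_adjoin _ _ (by simp))
  obtain ⟨y', hy'⟩ := hlift y (IntermediateField.subset_adjoin _ _ (by simp))
  refine ⟨L, inferInstance, inferInstance, hfin, hL, t', t' * y', ?_⟩
  apply RingOfIntegers.coe_injective
  apply (algebraMap L F).injective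
  have hf : ∀ x : 𝓞 K, algebraMap L F (algebraMap (𝓞 L) L (algebraMap (𝓞 K) (𝓞 L) x)) = f x :=
    fun _ => rfl
  simp only [map_sum, map_mul, map_pow, hf, ht', hy']
  have hval := congrArg (eval (y : F)) hP
  simp only [eval_finsetSum, eval_mul, eval_C, eval_pow, eval_X, eval_map_apply] at hval
  have hvF : (v : F) * (P.eval y : 𝓞 F) = 1 := by rw [← map_mul, hv, map_one]
  have htF : (t : F) ^ d = algebraMap (𝓞 F) F s * v := by rw [← map_pow, ht, map_mul]
  calc _ = (t : F) ^ d * ∑ i : Fin (d + 1), f (h i) * (y : F) ^ (i : ℕ) := by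
        rw [Finset.mul_sum]
        refine Finset.sum_congr rfl fun i _ => ?_
        have : (t : F) ^ d = t ^ (d - (i : ℕ)) * t ^ (i : ℕ) := by
          rw [← pow_add, Nat.sub_add_cancel (Nat.lt_succ_iff.1 i.2)]
        rw [this]
        ring
    _ = f k := by
        rw [hval, htF, hs]
        linear_combination (algebraMap (𝓞 F) F s * c) * hvF
end

section
/- Let K be a quadratic number field of discriminant D. There is a bijection between: (i) the set of primitive integral binary quadratic forms q(x,y) = a x² + b xy + c y² with a,b,c ∈ Z, gcd(a,b,c) = 1 and b² − 4ac = D, modulo the action of SL_2(Z) by invertible integral change of variables; and (ii) the set of pairs (𝔞, s), where 𝔞 is a nonzero fractional ideal of K and s ∈ {+1, −1}, modulo the equivalence (𝔞, s) ∼ (𝔟, s') if and only if there exists x ∈ K^× with 𝔞 = x·𝔟 and s = sign(N_{K/Q}(x))·s'. -/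
open NumberField

/-- The `SL₂(ℤ)`-equivalence of (primitive, discriminant `D`) integral binary quadratic
forms, a form being recorded as its coefficient triple `(a, b, c)`. -/
def stmt15FormsRel (D : ℤ)
    (f g : {v : ℤ × ℤ × ℤ //
      Int.gcd (Int.gcd v.1 v.2.1) v.2.2 = 1 ∧ v.2.1 ^ 2 - 4 * v.1 * v.2.2 = D}) : Prop :=
  ∃ γ : Matrix.SpecialLinearGroup (Fin 2) ℤ, ∀ x y : ℤ,
    g.1.1 * x ^ 2 + g.1.2.1 * x * y + g.1.2.2 * y ^ 2 =
      f.1.1 * (γ.1 0 0 * x + γ.1 0 1 * y) ^ 2 +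
        f.1.2.1 * (γ.1 0 0 * x + γ.1 0 1 * y) * (γ.1 1 0 * x + γ.1 1 1 * y) +
        f.1.2.2 * (γ.1 1 0 * x + γ.1 1 1 * y) ^ 2

/-- The equivalence `(𝔞, s) ∼ (𝔟, s')` iff `𝔞 = x·𝔟` and `s = sign(N(x))·s'` for some
`x ∈ K˟`. -/
def stmt15PairsRel (K : Type) [Field K] [NumberField K]
    (P Q : {P : FractionalIdeal (nonZeroDivisors (𝓞 K)) K × ℤ //
      P.1 ≠ 0 ∧ (P.2 = 1 ∨ P.2 = -1)}) : Prop :=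
  ∃ x : K, x ≠ 0 ∧
    P.1.1 = FractionalIdeal.spanSingleton (nonZeroDivisors (𝓞 K)) x * Q.1.1 ∧
    P.1.2 = (if 0 < Algebra.norm ℚ x then 1 else -1) * Q.1.2

/-- Coordinates on a quadratic field of discriminant `D` with respect to `1` and a square root `δ`
of `D`, together with an integer `ω = (t + δ) / 2` such that `1, ω` span the ring of integers. -/
structure QuadraticCoords (K : Type) [Field K] [NumberField K] (D : ℤ) where
  δ : K
  re : K →ₗ[ℚ] ℚ
  im : K →ₗ[ℚ] ℚ
  t : ℤ
  n : ℤ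
  ω : 𝓞 K
  eq_re_add_im : ∀ x, x = (re x : K) + (im x : K) * δ
  δ_sq : δ ^ 2 = (D : K)
  re_δ : re δ = 0
  im_δ : im δ = 1
  re_one : re 1 = 1
  im_one : im 1 = 0
  norm_eq : ∀ x, Algebra.norm ℚ x = re x ^ 2 - D * im x ^ 2
  two_mul_ω : 2 * (ω : K) = t + δ
  disc_eq : D = t ^ 2 - 4 * n
  exists_int : ∀ x : 𝓞 K, ∃ m k : ℤ, x = m + k * ω

/-- The ring of integers of a quadratic field has an integral basis starting with `1`. -/
lemma exists_basis_one (K : Type) [Field K] [NumberField K] (hK : Module.finrank ℚ K = 2) :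
    ∃ b : Module.Basis (Fin 2) ℤ (𝓞 K), b 0 = 1 := by
  have hrank : Module.finrank ℤ (𝓞 K) = 2 := by rw [RingOfIntegers.rank, hK]
  let e : Module.Basis (Fin 2) ℤ (𝓞 K) := Module.finBasisOfFinrankEq ℤ (𝓞 K) hrank
  obtain ⟨m, n, hmn⟩ : ∃ m n : ℤ, (1 : 𝓞 K) = m • e 0 + n • e 1 :=
    ⟨e.repr 1 0, e.repr 1 1, by simpa [Fin.sum_univ_two] using (e.sum_repr 1).symm⟩
  have hg : IsCoprime m n := by
    rw [Int.isCoprime_iff_gcd_eq_one]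
    obtain ⟨m', hm'⟩ := Int.gcd_dvd_left m n
    obtain ⟨n', hn'⟩ := Int.gcd_dvd_right m n
    set g := Int.gcd m n
    have h1 : (1 : 𝓞 K) = algebraMap ℤ (𝓞 K) g * (m' • e 0 + n' • e 1) := by
      have hmO := congrArg (Int.cast : ℤ → 𝓞 K) hm'
      have hnO := congrArg (Int.cast : ℤ → 𝓞 K) hn'
      rw [hmn]
      simp only [zsmul_eq_mul, eq_intCast]
      push_cast at hmO hnO ⊢
      linear_combination e 0 * hmO + e 1 * hnO
    have h2 := congrArg (Algebra.norm ℤ) h1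
    rw [map_one, map_mul, Algebra.norm_algebraMap, hrank] at h2
    have : (g : ℤ) ∣ 1 := by
      rw [h2]
      exact Dvd.dvd.mul_right (dvd_pow_self _ two_ne_zero) _
    exact_mod_cast Int.eq_one_of_dvd_one (by positivity) this
  obtain ⟨r, s, hrs⟩ := hg
  have hli : LinearIndependent ℤ ![(1 : 𝓞 K), (-s) • e 0 + r • e 1] := by
    rw [LinearIndependent.pair_iff]
    intro x y hxy
    rw [hmn] at hxy
    have h0 := congrArg (fun z => e.repr z 0) hxy
    have h1 := congrArg (fun z => e.repr z 1) hxy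
    simp [-zsmul_eq_mul] at h0 h1
    constructor
    · linear_combination (-x) * hrs + r * h0 + s * h1
    · linear_combination (-y) * hrs + m * h1 - n * h0
  have hsp : ⊤ ≤ Submodule.span ℤ (Set.range ![(1 : 𝓞 K), (-s) • e 0 + r • e 1]) := by
    have hrsO : (r : 𝓞 K) * m + s * n = 1 := by exact_mod_cast congrArg (Int.cast : ℤ → 𝓞 K) hrs
    rw [← e.span_eq, Submodule.span_le]
    rintro _ ⟨i, rfl⟩
    simp only [Matrix.range_cons, Matrix.range_empty, Set.union_empty, Set.singleton_union,
      SetLike.mem_coe, Submodule.mem_span_pair]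
    fin_cases i
    · refine ⟨r, -n, ?_⟩
      rw [hmn]
      simp only [zsmul_eq_mul, Fin.zero_eta]
      push_cast
      linear_combination e 0 * hrsO
    · refine ⟨s, m, ?_⟩
      rw [hmn]
      simp only [zsmul_eq_mul, Fin.mk_one]
      push_cast
      linear_combination e 1 * hrsO
  exact ⟨Module.Basis.mk hli hsp, by simp⟩

lemma nonempty_quadraticCoords (K : Type) [Field K] [NumberField K]
    (hK : Module.finrank ℚ K = 2) {D : ℤ} (hD : NumberField.discr K = D) :
    Nonempty (QuadraticCoords K D) := by
  obtain ⟨b, hb⟩ := exists_basis_one K hK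
  obtain ⟨n, t, hnt⟩ : ∃ n t : ℤ, b 1 * b 1 = t * b 1 - n := by
    refine ⟨-b.repr (b 1 * b 1) 0, b.repr (b 1 * b 1) 1, ?_⟩
    have := b.sum_repr (b 1 * b 1)
    simp only [Fin.sum_univ_two, hb, zsmul_eq_mul] at this
    push_cast
    linear_combination -this
  have hone : b.repr 1 = Finsupp.single 0 1 := by rw [← hb, b.repr_self]
  have hint (k : ℤ) : b.repr (k : 𝓞 K) = Finsupp.single 0 k := by
    rw [← zsmul_one, map_zsmul, hone]; simp
  have hmulb (k : ℤ) : b.repr ((k : 𝓞 K) * b 1) = Finsupp.single 1 k := by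
    rw [← zsmul_eq_mul, map_zsmul, b.repr_self]; simp
  have htr1 : Algebra.trace ℤ (𝓞 K) (b 1) = t := by
    rw [Algebra.trace_eq_matrix_trace b, Matrix.trace_fin_two]
    simp [Algebra.leftMulMatrix_eq_repr_mul, hb, hnt, hint, hmulb]
  have htr0 : Algebra.trace ℤ (𝓞 K) 1 = 2 := by
    rw [Algebra.trace_eq_matrix_trace b, Matrix.trace_fin_two]
    simp
  have hdisc : D = t ^ 2 - 4 * n := by
    rw [← hD, ← discr_eq_discr K b, Algebra.discr_def, Matrix.det_fin_two]
    have htr2 : Algebra.trace ℤ (𝓞 K) (b 1 * b 1) = t * t - 2 * n := by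
      have : b 1 * b 1 = t • b 1 - n • 1 := by simp [hnt]
      rw [this, map_sub, map_zsmul, map_zsmul, htr1, htr0]
      simp
      ring
    simp only [Algebra.traceMatrix_apply, Algebra.traceForm_apply, htr2, hb, one_mul, mul_one, htr1,
      htr0]
    ring
  let B : Module.Basis (Fin 2) ℚ K := b.localizationLocalization ℚ (nonZeroDivisors ℤ) K
  have hB0 : B 0 = 1 := by simp [B, hb]
  have hB1 : B 1 = (b 1 : 𝓞 K) := by simp [B]
  have hBB : B 1 * B 1 = (t : ℚ) • B 1 - (n : ℚ) • B 0 := by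
    rw [hB0, hB1]
    have := congrArg (algebraMap (𝓞 K) K) hnt
    simp only [map_mul, map_sub, map_intCast] at this
    simp only [Rat.smul_def, Rat.cast_intCast, mul_one]
    exact this
  have hBr (x : K) : x = (B.repr x 0) • 1 + (B.repr x 1) • B 1 := by
    conv_lhs => rw [← B.sum_repr x, Fin.sum_univ_two, hB0]
  have hB0' : B.repr 1 = Finsupp.single 0 1 := by rw [← hB0, B.repr_self]
  refine ⟨⟨2 * B 1 - t, B.coord 0 + (t / 2 : ℚ) • B.coord 1, (1 / 2 : ℚ) • B.coord 1, t, n, b 1,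
    ?_, ?_, ?_, ?_, ?_, ?_, ?_, ?_, hdisc, ?_⟩⟩
  · intro x
    conv_lhs => rw [hBr x]
    simp only [Rat.smul_def, LinearMap.add_apply, LinearMap.smul_apply, Module.Basis.coord_apply,
      smul_eq_mul]
    push_cast
    ring
  · rw [hdisc]
    simp only [Rat.smul_def, hB0, Rat.cast_intCast] at hBB
    push_cast
    linear_combination 4 * hBB
  · have : (2 * B 1 - t : K) = (2 : ℚ) • B 1 - (t : ℚ) • B 0 := by simp [hB0, Rat.smul_def]
    rw [this]
    simp
  · have : (2 * B 1 - t : K) = (2 : ℚ) • B 1 - (t : ℚ) • B 0 := by simp [hB0, Rat.smul_def]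
    rw [this]
    simp
  · simp [hB0']
  · simp [hB0']
  · intro x
    rw [Algebra.norm_eq_matrix_det B, Matrix.det_fin_two]
    have h1 : x * B 1 = (B.repr x 0 + t * B.repr x 1) • B 1 - (n * B.repr x 1) • B 0 := by
      conv_lhs => rw [hBr x]
      simp only [Rat.smul_def, hB0, Rat.cast_intCast] at hBB ⊢
      push_cast
      linear_combination (B.repr x 1 : K) * hBB
    have e0 : B.repr (x * B 1) 0 = - (n * B.repr x 1) := by
      rw [h1]; simp
    have e1 : B.repr (x * B 1) 1 = B.repr x 0 + t * B.repr x 1 := by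
      rw [h1]; simp
    simp only [Algebra.leftMulMatrix_eq_repr_mul, e0, e1, hB0, mul_one, hdisc]
    simp
    ring
  · rw [hB1]; ring
  · intro x
    refine ⟨b.repr x 0, b.repr x 1, ?_⟩
    have := b.sum_repr x
    simpa [Fin.sum_univ_two, hb] using this.symm

namespace QuadraticCoords

variable {K : Type} [Field K] [NumberField K] {D : ℤ} (Q : QuadraticCoords K D)

lemma re_ratCast (q : ℚ) : Q.re (q : K) = q := by
  have : (q : K) = q • (1 : K) := by simp [Rat.smul_def]
  rw [this, map_smul, Q.re_one, smul_eq_mul, mul_one]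

lemma im_ratCast (q : ℚ) : Q.im (q : K) = 0 := by
  have : (q : K) = q • (1 : K) := by simp [Rat.smul_def]
  rw [this, map_smul, Q.im_one, smul_zero]

lemma re_intCast (m : ℤ) : Q.re (m : K) = m := by
  simpa using Q.re_ratCast m

lemma im_intCast (m : ℤ) : Q.im (m : K) = 0 := by
  simpa using Q.im_ratCast m

lemma re_im_mk (p q : ℚ) :
    Q.re ((p : K) + (q : K) * Q.δ) = p ∧ Q.im ((p : K) + (q : K) * Q.δ) = q := by
  have : (q : K) * Q.δ = q • Q.δ := by simp [Rat.smul_def]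
  simp [this, Q.re_ratCast, Q.im_ratCast, Q.re_δ, Q.im_δ]

lemma re_im_mul (x y : K) :
    Q.re (x * y) = Q.re x * Q.re y + D * Q.im x * Q.im y ∧
      Q.im (x * y) = Q.re x * Q.im y + Q.im x * Q.re y := by
  have h : x * y = ((Q.re x * Q.re y + D * Q.im x * Q.im y : ℚ) : K) +
      ((Q.re x * Q.im y + Q.im x * Q.re y : ℚ) : K) * Q.δ := by
    conv_lhs => rw [Q.eq_re_add_im x, Q.eq_re_add_im y]
    push_cast
    linear_combination (Q.im x : K) * Q.im y * Q.δ_sq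
  rw [h]
  exact Q.re_im_mk _ _

lemma re_mul (x y : K) : Q.re (x * y) = Q.re x * Q.re y + D * Q.im x * Q.im y :=
  (Q.re_im_mul x y).1

lemma im_mul (x y : K) : Q.im (x * y) = Q.re x * Q.im y + Q.im x * Q.re y :=
  (Q.re_im_mul x y).2

lemma re_intCast_mul (m : ℤ) (x : K) : Q.re (m * x) = m * Q.re x := by
  simp [Q.re_mul, Q.re_intCast, Q.im_intCast]

lemma im_intCast_mul (m : ℤ) (x : K) : Q.im (m * x) = m * Q.im x := by
  simp [Q.im_mul, Q.re_intCast, Q.im_intCast]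

lemma ext {x y : K} (hre : Q.re x = Q.re y) (him : Q.im x = Q.im y) : x = y := by
  rw [Q.eq_re_add_im x, Q.eq_re_add_im y, hre, him]

lemma re_im_ω : Q.re (Q.ω : K) = Q.t / 2 ∧ Q.im (Q.ω : K) = 1 / 2 := by
  have h : (Q.ω : K) = ((Q.t / 2 : ℚ) : K) + ((1 / 2 : ℚ) : K) * Q.δ := by
    push_cast
    linear_combination (1 / 2 : K) * Q.two_mul_ω
  rw [h]
  exact Q.re_im_mk _ _

/-- The oriented area spanned by `α` and `β`, that is,
`conj α * β - α * conj β` divided by `δ`. -/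
def area (α β : K) : ℚ := 2 * (Q.re α * Q.im β - Q.im α * Q.re β)

lemma area_mul (x α β : K) : Q.area (x * α) (x * β) = Algebra.norm ℚ x * Q.area α β := by
  simp only [area, Q.re_mul, Q.im_mul, Q.norm_eq]
  ring

lemma area_comb (p q r s : ℤ) (α β : K) :
    Q.area (p * α + r * β) (q * α + s * β) = (p * s - q * r) * Q.area α β := by
  simp only [area, map_add, Q.re_intCast_mul, Q.im_intCast_mul]
  ring

/-- The form `a x² + b x y + c y²` equals `N(x α + y β) / area α β`. -/
def IsNormForm (a b c : ℤ) (α β : K) : Prop :=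
  Algebra.norm ℚ α = a * Q.area α β ∧
    2 * (Q.re α * Q.re β - D * Q.im α * Q.im β) = b * Q.area α β ∧
    Algebra.norm ℚ β = c * Q.area α β

/-- The integers `a, b, c` are the coefficients of the norm form attached to a `ℤ`-basis of `I`
whose orientation is given by the sign `s`. -/
def IsFormOf (a b c : ℤ) (I : FractionalIdeal (nonZeroDivisors (𝓞 K)) K) (s : ℤ) : Prop :=
  ∃ α β : K, (∀ x, x ∈ I ↔ ∃ m k : ℤ, x = m * α + k * β) ∧ 0 < s * Q.area α β ∧
    Q.IsNormForm a b c α β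

variable {Q}

lemma IsNormForm.comb {a b c : ℤ} {α β : K} (h : Q.IsNormForm a b c α β) {p q r s : ℤ}
    (hdet : p * s - q * r = 1) :
    Q.IsNormForm (a * p ^ 2 + b * p * r + c * r ^ 2)
      (2 * a * p * q + b * (p * s + q * r) + 2 * c * r * s)
      (a * q ^ 2 + b * q * s + c * s ^ 2) (p * α + r * β) (q * α + s * β) := by
  obtain ⟨h1, h2, h3⟩ := h
  have hdet' : (p * s - q * r : ℚ) = 1 := by exact_mod_cast hdet
  simp only [IsNormForm, area_comb, hdet', one_mul, Q.norm_eq, map_add, Q.re_intCast_mul,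
    Q.im_intCast_mul] at h1 h2 h3 ⊢
  push_cast
  refine ⟨?_, ?_, ?_⟩
  · linear_combination (p : ℚ) ^ 2 * h1 + (p : ℚ) * r * h2 + (r : ℚ) ^ 2 * h3
  · linear_combination 2 * (p : ℚ) * q * h1 + ((p : ℚ) * s + q * r) * h2 + 2 * (r : ℚ) * s * h3
  · linear_combination (q : ℚ) ^ 2 * h1 + (q : ℚ) * s * h2 + (s : ℚ) ^ 2 * h3

lemma IsNormForm.mul {a b c : ℤ} {α β : K} (h : Q.IsNormForm a b c α β) (x : K) :
    Q.IsNormForm a b c (x * α) (x * β) := by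
  obtain ⟨h1, h2, h3⟩ := h
  refine ⟨?_, ?_, ?_⟩
  · rw [area_mul, map_mul, h1]; ring
  · rw [area_mul, Q.re_mul, Q.re_mul, Q.im_mul, Q.im_mul, Q.norm_eq]
    linear_combination (Q.re x ^ 2 - D * Q.im x ^ 2) * h2
  · rw [area_mul, map_mul, h3]; ring

lemma IsNormForm.unique {a b c a' b' c' : ℤ} {α β : K} (h : Q.IsNormForm a b c α β)
    (h' : Q.IsNormForm a' b' c' α β) (h0 : Q.area α β ≠ 0) : a = a' ∧ b = b' ∧ c = c' := by
  obtain ⟨h1, h2, h3⟩ := h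
  obtain ⟨h1', h2', h3'⟩ := h'
  refine ⟨?_, ?_, ?_⟩
  · exact_mod_cast mul_right_cancel₀ h0 (h1.symm.trans h1')
  · exact_mod_cast mul_right_cancel₀ h0 (h2.symm.trans h2')
  · exact_mod_cast mul_right_cancel₀ h0 (h3.symm.trans h3')

lemma IsNormForm.ne_zero {a b c : ℤ} {α β : K} (h : Q.IsNormForm a b c α β)
    (h0 : Q.area α β ≠ 0) : (a : ℚ) ≠ 0 := by
  rintro ha
  have h1 := h.1
  rw [ha, zero_mul, Algebra.norm_eq_zero_iff] at h1
  apply h0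
  simp [area, h1]

/-- The ratio of the two basis elements is determined by the form. -/
lemma IsNormForm.two_mul_mul {a b c : ℤ} {α β : K} (h : Q.IsNormForm a b c α β)
    (h0 : Q.area α β ≠ 0) : (2 * a : ℤ) * β = ((b : ℤ) + Q.δ) * α := by
  obtain ⟨h1, h2, -⟩ := h
  rw [Q.norm_eq] at h1
  apply Q.ext
  · rw [Q.re_intCast_mul, add_mul, map_add, Q.re_intCast_mul, Q.re_mul, Q.re_δ, Q.im_δ]
    apply mul_right_cancel₀ h0
    push_cast
    have : Q.area α β = 2 * (Q.re α * Q.im β - Q.im α * Q.re β) := rfl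
    linear_combination (-2 * Q.re β) * h1 + Q.re α * h2 - D * Q.im α * this
  · rw [Q.im_intCast_mul, add_mul, map_add, Q.im_intCast_mul, Q.im_mul, Q.re_δ, Q.im_δ]
    apply mul_right_cancel₀ h0
    push_cast
    have : Q.area α β = 2 * (Q.re α * Q.im β - Q.im α * Q.re β) := rfl
    linear_combination (-2 * Q.im β) * h1 + Q.im α * h2 - Q.re α * this

lemma mem_lattice_mul {I : FractionalIdeal (nonZeroDivisors (𝓞 K)) K} {α β : K}
    (h : ∀ x, x ∈ I ↔ ∃ m k : ℤ, x = m * α + k * β) (y x : K) :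
    x ∈ FractionalIdeal.spanSingleton (nonZeroDivisors (𝓞 K)) y * I ↔
      ∃ m k : ℤ, x = m * (y * α) + k * (y * β) := by
  rw [FractionalIdeal.mem_singleton_mul]
  constructor
  · rintro ⟨z, hz, rfl⟩
    obtain ⟨m, k, rfl⟩ := (h z).1 hz
    exact ⟨m, k, by ring⟩
  · rintro ⟨m, k, rfl⟩
    exact ⟨m * α + k * β, (h _).2 ⟨m, k, rfl⟩, by ring⟩

lemma IsFormOf.smul {a b c : ℤ} {I : FractionalIdeal (nonZeroDivisors (𝓞 K)) K} {s : ℤ}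
    (h : Q.IsFormOf a b c I s) {x : K} (hx : x ≠ 0) :
    Q.IsFormOf a b c (FractionalIdeal.spanSingleton (nonZeroDivisors (𝓞 K)) x * I)
      ((if 0 < Algebra.norm ℚ x then 1 else -1) * s) := by
  obtain ⟨α, β, hI, hs, hf⟩ := h
  refine ⟨x * α, x * β, mem_lattice_mul hI x, ?_, hf.mul x⟩
  have hn : Algebra.norm ℚ x ≠ 0 := Algebra.norm_ne_zero_iff.2 hx
  rw [area_mul]
  split_ifs with hp
  · push_cast
    nlinarith [mul_pos hp hs]
  · have hp' : 0 < -Algebra.norm ℚ x := by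
      rcases lt_or_gt_of_ne hn with h | h
      · linarith
      · exact absurd h hp
    push_cast
    nlinarith [mul_pos hp' hs]

lemma IsFormOf.exists_eq_smul {a b c : ℤ} {I J : FractionalIdeal (nonZeroDivisors (𝓞 K)) K}
    {s r : ℤ} (hs : s = 1 ∨ s = -1) (hr : r = 1 ∨ r = -1)
    (h : Q.IsFormOf a b c I s) (h' : Q.IsFormOf a b c J r) :
    ∃ x : K, x ≠ 0 ∧ I = FractionalIdeal.spanSingleton (nonZeroDivisors (𝓞 K)) x * J ∧
      s = (if 0 < Algebra.norm ℚ x then 1 else -1) * r := by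
  obtain ⟨α, β, hI, hsp, hf⟩ := h
  obtain ⟨α', β', hJ, hrp, hf'⟩ := h'
  have h0 : Q.area α β ≠ 0 := right_ne_zero_of_mul hsp.ne'
  have h0' : Q.area α' β' ≠ 0 := right_ne_zero_of_mul hrp.ne'
  have ha := hf.ne_zero h0
  have haK : (2 * a : K) ≠ 0 := by
    have : (a : K) ≠ 0 := by exact_mod_cast ha
    simpa using this
  have hα : α ≠ 0 := by rintro rfl; exact h0 (by simp [area])
  have hα' : α' ≠ 0 := by rintro rfl; exact h0' (by simp [area])
  have h1 := hf.two_mul_mul h0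
  have h1' := hf'.two_mul_mul h0'
  push_cast at h1 h1'
  obtain ⟨x, hx⟩ : ∃ x, α = x * α' := ⟨α / α', by field_simp⟩
  have hx0 : x ≠ 0 := by rintro rfl; simp [hα] at hx
  have hxβ : β = x * β' := by
    apply mul_left_cancel₀ haK
    linear_combination h1 - x * h1' + (b + Q.δ) * hx
  refine ⟨x, hx0, ?_, ?_⟩
  · ext y
    rw [mem_lattice_mul hJ, ← hx, ← hxβ, hI]
  · rw [hx, hxβ, area_mul] at hsp
    have hn : Algebra.norm ℚ x ≠ 0 := Algebra.norm_ne_zero_iff.2 hx0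
    have hsr : 0 < (s * r : ℚ) * Algebra.norm ℚ x := by
      have := mul_pos hsp hrp
      have hsq : 0 < Q.area α' β' ^ 2 := by positivity
      refine pos_of_mul_pos_left (b := Q.area α' β' ^ 2) ?_ hsq.le
      linarith
    rcases hs with rfl | rfl <;> rcases hr with rfl | rfl <;> split_ifs with hp <;>
      norm_num at hsr ⊢ <;> linarith

lemma IsFormOf.exists_matrix {a b c a' b' c' : ℤ}
    {I : FractionalIdeal (nonZeroDivisors (𝓞 K)) K} {s : ℤ}
    (h : Q.IsFormOf a b c I s) (h' : Q.IsFormOf a' b' c' I s) :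
    ∃ p q r t : ℤ, p * t - q * r = 1 ∧ a' = a * p ^ 2 + b * p * r + c * r ^ 2 ∧
      b' = 2 * a * p * q + b * (p * t + q * r) + 2 * c * r * t ∧
      c' = a * q ^ 2 + b * q * t + c * t ^ 2 := by
  obtain ⟨α, β, hI, hsp, hf⟩ := h
  obtain ⟨α', β', hI', hsp', hf'⟩ := h'
  have h0 : Q.area α β ≠ 0 := right_ne_zero_of_mul hsp.ne'
  have h0' : Q.area α' β' ≠ 0 := right_ne_zero_of_mul hsp'.ne'
  obtain ⟨p, r, hα'⟩ := (hI α').1 ((hI' α').2 ⟨1, 0, by simp⟩)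
  obtain ⟨q, t, hβ'⟩ := (hI β').1 ((hI' β').2 ⟨0, 1, by simp⟩)
  obtain ⟨p', r', hα⟩ := (hI' α).1 ((hI α).2 ⟨1, 0, by simp⟩)
  obtain ⟨q', t', hβ⟩ := (hI' β).1 ((hI β).2 ⟨0, 1, by simp⟩)
  have e1 : Q.area α' β' = (p * t - q * r) * Q.area α β := by rw [hα', hβ', area_comb]
  have e2 : Q.area α β = (p' * t' - q' * r') * Q.area α' β' := by
    conv_lhs => rw [hα, hβ, area_comb]
  have hpos : (0 : ℚ) < p * t - q * r := by
    have := mul_pos hsp hsp'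
    rw [e1] at this
    have hsq : 0 < (s * Q.area α β) ^ 2 := pow_pos hsp 2
    refine pos_of_mul_pos_left (b := (s * Q.area α β) ^ 2) ?_ hsq.le
    linarith
  have hdvd : (p' * t' - q' * r') * (p * t - q * r) = 1 := by
    have : ((p' * t' - q' * r') * (p * t - q * r) : ℚ) = 1 := by
      apply mul_right_cancel₀ h0
      rw [one_mul, mul_assoc, ← e1, ← e2]
    exact_mod_cast this
  have hdet : p * t - q * r = 1 :=
    Int.eq_one_of_dvd_one (by exact_mod_cast hpos.le) ⟨_, by rw [mul_comm, hdvd]⟩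
  have hu := hf.comb hdet
  rw [← hα', ← hβ'] at hu
  exact ⟨p, q, r, t, hdet, hf'.unique hu h0'⟩

lemma IsFormOf.of_matrix {a b c : ℤ}
    {I : FractionalIdeal (nonZeroDivisors (𝓞 K)) K} {s : ℤ} (h : Q.IsFormOf a b c I s)
    {p q r t : ℤ} (hdet : p * t - q * r = 1) :
    Q.IsFormOf (a * p ^ 2 + b * p * r + c * r ^ 2)
      (2 * a * p * q + b * (p * t + q * r) + 2 * c * r * t)
      (a * q ^ 2 + b * q * t + c * t ^ 2) I s := by
  obtain ⟨α, β, hI, hsp, hf⟩ := h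
  refine ⟨p * α + r * β, q * α + t * β, ?_, ?_, hf.comb hdet⟩
  · intro x
    rw [hI]
    have hdetK : (p * t - q * r : K) = 1 := by exact_mod_cast congrArg (Int.cast : ℤ → K) hdet
    constructor
    · rintro ⟨m, k, rfl⟩
      refine ⟨m * t - k * q, k * p - m * r, ?_⟩
      push_cast
      linear_combination (-(m * α + k * β)) * hdetK
    · rintro ⟨m, k, rfl⟩
      refine ⟨m * p + k * q, m * r + k * t, ?_⟩
      push_cast
      ring
  · have hdet' : (p * t - q * r : ℚ) = 1 := by exact_mod_cast hdet
    rwa [area_comb, hdet', one_mul]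

variable (Q)

lemma exists_isFormOf_of_form {a b c : ℤ} (hD : b ^ 2 - 4 * a * c = D) :
    ∃ (I : FractionalIdeal (nonZeroDivisors (𝓞 K)) K) (s : ℤ), I ≠ 0 ∧ (s = 1 ∨ s = -1) ∧
      Q.IsFormOf a b c I s := by
  have ha : a ≠ 0 := by
    rintro rfl
    have hsq := Q.δ_sq
    have hDK : (D : K) = (b : K) ^ 2 := by rw [← hD]; push_cast; ring
    have : (Q.δ - (b : K)) * (Q.δ + (b : K)) = 0 := by
      linear_combination hsq + hDK
    rcases mul_eq_zero.1 this with h | h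
    · simpa [Q.im_δ, Q.im_intCast] using congrArg Q.im h
    · simpa [Q.im_δ, Q.im_intCast] using congrArg Q.im h
  obtain ⟨l, hl⟩ : ∃ l, Q.t = b + 2 * l := by
    have h : (b ^ 2 : ℤ) % 2 = (Q.t ^ 2) % 2 := by
      have := Q.disc_eq
      have h2 : Q.t ^ 2 = b ^ 2 - 2 * (2 * a * c) + 2 * (2 * Q.n) := by linarith
      rw [h2]; omega
    have hp : b % 2 = Q.t % 2 := by
      rcases Int.emod_two_eq_zero_or_one b with h1 | h1 <;>
      rcases Int.emod_two_eq_zero_or_one Q.t with h2 | h2 <;>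
      simp [pow_two, Int.mul_emod, h1, h2] at h ⊢
    exact ⟨(Q.t - b) / 2, by omega⟩
  obtain ⟨η, hη⟩ : ∃ η : K, Q.ω = η + l := ⟨Q.ω - l, by ring⟩
  have hη2 : 2 * η = b + Q.δ := by
    have h1 := Q.two_mul_ω
    have h2 : (Q.t : K) = b + 2 * l := by exact_mod_cast congrArg (Int.cast : ℤ → K) hl
    rw [hη, h2] at h1
    linear_combination h1
  have hηη : η * η = b * η - a * c := by
    have h1 : (D : K) = b ^ 2 - 4 * a * c := by exact_mod_cast congrArg (Int.cast : ℤ → K) hD.symm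
    have h2 := Q.δ_sq
    have h3 : Q.δ = 2 * η - b := by linear_combination -hη2
    rw [h3, h1] at h2
    linear_combination (1 / 4 : K) * h2
  have hηre : Q.re η = b / 2 ∧ Q.im η = 1 / 2 := by
    have h : η = ((b / 2 : ℚ) : K) + ((1 / 2 : ℚ) : K) * Q.δ := by
      push_cast
      linear_combination (1 / 2 : K) * hη2
    rw [h]
    exact Q.re_im_mk _ _
  let M : Submodule (𝓞 K) K := Submodule.span (𝓞 K) {(a : K), η}
  have hM : IsFractional (nonZeroDivisors (𝓞 K)) M :=
    FractionalIdeal.isFractional_of_fg (Submodule.fg_span (by simp))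
  have hmem (x : K) : x ∈ M ↔ ∃ m k : ℤ, x = m * (a : K) + k * η := by
    constructor
    · intro hx
      induction hx using Submodule.span_induction with
      | mem x hx =>
        rcases hx with rfl | rfl
        · exact ⟨1, 0, by simp⟩
        · exact ⟨0, 1, by simp⟩
      | zero => exact ⟨0, 0, by simp⟩
      | add x y _ _ hx hy =>
        obtain ⟨m, k, rfl⟩ := hx
        obtain ⟨m', k', rfl⟩ := hy
        exact ⟨m + m', k + k', by push_cast; ring⟩
      | smul o x _ hx =>
        obtain ⟨m, k, rfl⟩ := hx
        obtain ⟨u, v, rfl⟩ := Q.exists_int o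
        refine ⟨m * u + m * v * l - k * v * c, k * u + k * v * l + m * v * a + k * v * b, ?_⟩
        rw [Algebra.smul_def]
        simp only [map_add, map_mul, map_intCast]
        rw [show algebraMap (𝓞 K) K Q.ω = η + l from hη]
        push_cast
        linear_combination (k * v : K) * hηη
    · rintro ⟨m, k, rfl⟩
      have h1 : (m : K) * (a : K) = (m : 𝓞 K) • (a : K) := by simp [Algebra.smul_def]
      have h2 : (k : K) * η = (k : 𝓞 K) • η := by simp [Algebra.smul_def]
      rw [h1, h2]
      exact M.add_mem (M.smul_mem _ (Submodule.subset_span (by simp)))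
        (M.smul_mem _ (Submodule.subset_span (by simp)))
  have hArea : Q.area (a : K) η = a := by
    rw [area, Q.re_intCast, Q.im_intCast, hηre.2]; ring
  obtain ⟨s, hs, hsa⟩ : ∃ s : ℤ, (s = 1 ∨ s = -1) ∧ 0 < s * a := by
    rcases lt_or_gt_of_ne ha with h | h
    · exact ⟨-1, by simp, by linarith⟩
    · exact ⟨1, by simp, by linarith⟩
  let I : FractionalIdeal (nonZeroDivisors (𝓞 K)) K := ⟨M, hM⟩
  refine ⟨I, s, ?_, hs, (a : K), η, fun x => hmem x, ?_, ?_, ?_, ?_⟩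
  · intro h0
    have : (a : K) ∈ M := (hmem _).2 ⟨1, 0, by simp⟩
    change (a : K) ∈ I at this
    rw [h0, FractionalIdeal.mem_zero_iff] at this
    exact ha (by exact_mod_cast this)
  · rw [hArea]; exact_mod_cast hsa
  · rw [hArea, Q.norm_eq, Q.re_intCast, Q.im_intCast]; ring
  · rw [hArea, Q.re_intCast, Q.im_intCast, hηre.1, hηre.2]; ring
  · rw [hArea, Q.norm_eq, hηre.1, hηre.2, ← hD]; push_cast; ring

lemma exists_oriented_basis (hK : Module.finrank ℚ K = 2)
    {I : FractionalIdeal (nonZeroDivisors (𝓞 K)) K} (hI : I ≠ 0) {s : ℤ}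
    (hs : s = 1 ∨ s = -1) :
    ∃ α β : K, (∀ x, x ∈ I ↔ ∃ m k : ℤ, x = m * α + k * β) ∧ 0 < s * Q.area α β := by
  let J : (FractionalIdeal (nonZeroDivisors (𝓞 K)) K)ˣ := Units.mk0 I hI
  let B := NumberField.basisOfFractionalIdeal K J
  have hcard : Fintype.card (Module.Free.ChooseBasisIndex ℤ J) = 2 := by
    rw [← Module.finrank_eq_card_basis B, hK]
  let e := Fintype.equivFinOfCardEq hcard
  let C := B.reindex e
  have hmem (x : K) : x ∈ I ↔ ∃ m k : ℤ, x = m * C 0 + k * C 1 := by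
    have h1 : x ∈ I ↔ x ∈ Submodule.span ℤ (Set.range C) := by
      rw [Module.Basis.range_reindex]
      exact (NumberField.mem_span_basisOfFractionalIdeal K (I := J)).symm
    have h2 : Set.range C = {C 0, C 1} := by
      ext y; simp [Fin.exists_fin_two, eq_comm]
    rw [h1, h2, Submodule.mem_span_pair]
    simp only [zsmul_eq_mul, eq_comm]
  have harea : Q.area (C 0) (C 1) ≠ 0 := by
    intro h0
    have hli := C.linearIndependent
    have hli2 : LinearIndependent ℚ ![C 0, C 1] := by
      convert hli using 1
      ext i; fin_cases i <;> rfl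
    rw [LinearIndependent.pair_iff] at hli2
    have h0' : Q.re (C 0) * Q.im (C 1) - Q.im (C 0) * Q.re (C 1) = 0 := by
      simpa [area] using h0
    have k1 := hli2 (Q.re (C 1)) (-Q.re (C 0)) (by
      apply Q.ext
      · simp; ring
      · simp; linarith)
    have k2 := hli2 (Q.im (C 1)) (-Q.im (C 0)) (by
      apply Q.ext
      · simp; linarith
      · simp; ring)
    exact C.ne_zero 1 (Q.ext (by simpa using k1.1) (by simpa using k2.1))
  by_cases hpos : 0 < s * Q.area (C 0) (C 1)
  · exact ⟨_, _, hmem, hpos⟩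
  · refine ⟨C 1, C 0, fun x => ?_, ?_⟩
    · rw [hmem]
      exact ⟨fun ⟨m, k, h⟩ => ⟨k, m, by rw [h, add_comm]⟩,
        fun ⟨m, k, h⟩ => ⟨k, m, by rw [h, add_comm]⟩⟩
    · have hs0 : (s : ℚ) ≠ 0 := by rcases hs with rfl | rfl <;> norm_num
      have hne : s * Q.area (C 0) (C 1) ≠ 0 := mul_ne_zero hs0 harea
      have hneg : s * Q.area (C 0) (C 1) < 0 := lt_of_le_of_ne (not_lt.1 hpos) hne
      have : Q.area (C 1) (C 0) = - Q.area (C 0) (C 1) := by simp only [area]; ring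
      rw [this]
      linarith

/-- A form of fundamental discriminant is primitive. -/
lemma gcd_eq_one (Q : QuadraticCoords K D) {a b c : ℤ} (hD : b ^ 2 - 4 * a * c = D) :
    Int.gcd (Int.gcd a b) c = 1 := by
  obtain ⟨c', hc⟩ := Int.gcd_dvd_right (Int.gcd a b : ℤ) c
  have hg := Int.gcd_dvd_left (Int.gcd a b : ℤ) c
  obtain ⟨a', ha⟩ := hg.trans (Int.gcd_dvd_left a b)
  obtain ⟨b', hb⟩ := hg.trans (Int.gcd_dvd_right a b)
  generalize Int.gcd (Int.gcd a b : ℤ) c = g at ha hb hc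
  have hg0 : (g : K) ≠ 0 := by
    intro h
    have : (g : ℤ) = 0 := by exact_mod_cast h
    rw [this] at ha hb hc
    have hDK : (D : K) = 0 := by rw [← hD, ha, hb, hc]; simp
    have h0 : Q.δ = 0 := by simpa [hDK] using Q.δ_sq
    simpa [h0] using Q.im_δ
  have hgq : (g : ℚ) ≠ 0 := by exact_mod_cast hg0
  have hint : IsIntegral ℤ ((b' + Q.δ / g) / 2) := by
    refine ⟨Polynomial.X ^ 2 - Polynomial.C b' * Polynomial.X + Polynomial.C (a' * c'), ?_, ?_⟩
    · monicity!
    · have h1 : (D : K) = (g : K) ^ 2 * (b' ^ 2 - 4 * a' * c') := by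
        rw [← hD, ha, hb, hc]; push_cast; ring
      have hsq := Q.δ_sq
      rw [h1] at hsq
      simp only [Polynomial.eval₂_add, Polynomial.eval₂_sub, Polynomial.eval₂_mul,
        Polynomial.eval₂_pow, Polynomial.eval₂_X, Polynomial.eval₂_C]
      simp only [eq_intCast]
      push_cast
      field_simp
      linear_combination hsq
  obtain ⟨m, k, hmk⟩ := Q.exists_int ⟨_, hint⟩
  have h2 := congrArg (fun z : 𝓞 K => Q.im (z : K)) hmk
  simp only [map_add, map_mul, map_intCast, Q.im_intCast_mul, Q.im_intCast, Q.re_im_ω.2] at h2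
  have h3 : ((b' + Q.δ / g) / 2 : K) = ((b' / 2 : ℚ) : K) + ((1 / (2 * g) : ℚ) : K) * Q.δ := by
    push_cast
    field_simp
  have h4 : (1 / (2 * g) : ℚ) = 0 + k * (1 / 2) := by
    rw [← h2, ← (Q.re_im_mk (b' / 2) (1 / (2 * g))).2, ← h3]
    rfl
  field_simp at h4
  have h5 : (1 : ℤ) = g * k := by
    have : (1 : ℚ) = g * k := by linarith
    exact_mod_cast this
  exact_mod_cast Int.eq_one_of_dvd_one (by positivity) ⟨k, h5⟩

lemma exists_isFormOf_of_ideal (hK : Module.finrank ℚ K = 2)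
    {I : FractionalIdeal (nonZeroDivisors (𝓞 K)) K} (hI : I ≠ 0) {s : ℤ}
    (hs : s = 1 ∨ s = -1) :
    ∃ a b c : ℤ, b ^ 2 - 4 * a * c = D ∧ Q.IsFormOf a b c I s := by
  obtain ⟨α, β, hmem, hpos⟩ := Q.exists_oriented_basis hK hI hs
  have h0 : Q.area α β ≠ 0 := right_ne_zero_of_mul hpos.ne'
  have hω (x : K) (hx : x ∈ I) : (Q.ω : K) * x ∈ I := by
    have := I.1.smul_mem Q.ω hx
    rwa [Algebra.smul_def] at this
  obtain ⟨p, a, h1⟩ := (hmem _).1 (hω α ((hmem α).2 ⟨1, 0, by simp⟩))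
  obtain ⟨c, l, h2⟩ := (hmem _).1 (hω β ((hmem β).2 ⟨0, 1, by simp⟩))
  have h1re := congrArg Q.re h1
  have h1im := congrArg Q.im h1
  have h2re := congrArg Q.re h2
  have h2im := congrArg Q.im h2
  simp only [map_add, Q.re_intCast_mul, Q.im_intCast_mul, Q.re_mul, Q.im_mul, Q.re_im_ω.1, Q.re_im_ω.2]
    at h1re h1im h2re h2im
  have hf : Q.IsNormForm a (2 * l - Q.t) (-c) α β := by
    simp only [IsNormForm, Q.norm_eq, area]
    push_cast
    refine ⟨?_, ?_, ?_⟩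
    · linear_combination 2 * Q.re α * h1im - 2 * Q.im α * h1re
    · linear_combination 4 * Q.re α * h2im - 4 * Q.im α * h2re
    · linear_combination 2 * Q.re β * h2im - 2 * Q.im β * h2re
  refine ⟨a, 2 * l - Q.t, -c, ?_, α, β, hmem, hpos, hf⟩
  obtain ⟨e1, e2, e3⟩ := hf
  generalize 2 * l - Q.t = b at e2
  generalize -c = c at e3
  have hd : (b ^ 2 - 4 * a * c : ℚ) = D := by
    apply mul_right_cancel₀ (pow_ne_zero 2 h0)
    have e4 : (b ^ 2 - 4 * a * c : ℚ) * Q.area α β ^ 2 =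
        (b * Q.area α β) ^ 2 - 4 * (a * Q.area α β) * (c * Q.area α β) := by ring
    rw [e4, ← e1, ← e2, ← e3, Q.norm_eq, Q.norm_eq, area]
    ring
  exact_mod_cast hd

end QuadraticCoords

/-- For a quadratic number field `K` of discriminant `D` there is a
bijection between primitive integral binary quadratic forms of discriminant `D` modulo
`SL₂(ℤ)` and pairs `(𝔞, s)` of a nonzero fractional ideal of `K` and a sign `s = ±1`,
modulo `(𝔞, s) ∼ (x𝔟, sign(N(x))·s')`. -/
theorem stmt_15 (K : Type) [Field K] [NumberField K] (hK : Module.finrank ℚ K = 2)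
    (D : ℤ) (hD : NumberField.discr K = D) :
    Nonempty (Quot (stmt15FormsRel D) ≃ Quot (stmt15PairsRel K)) := by
  obtain ⟨Q⟩ := nonempty_quadraticCoords K hK hD
  let R (f : {v : ℤ × ℤ × ℤ //
      Int.gcd (Int.gcd v.1 v.2.1) v.2.2 = 1 ∧ v.2.1 ^ 2 - 4 * v.1 * v.2.2 = D})
      (P : {P : FractionalIdeal (nonZeroDivisors (𝓞 K)) K × ℤ //
      P.1 ≠ 0 ∧ (P.2 = 1 ∨ P.2 = -1)}) : Prop :=
    Q.IsFormOf f.1.1 f.1.2.1 f.1.2.2 P.1.1 P.1.2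
  have total (f) : ∃ P, R f P := by
    obtain ⟨I, s, hI, hs, h⟩ := Q.exists_isFormOf_of_form f.2.2
    exact ⟨⟨(I, s), hI, hs⟩, h⟩
  have surj (P) : ∃ f, R f P := by
    obtain ⟨a, b, c, hd, h⟩ := Q.exists_isFormOf_of_ideal hK P.2.1 P.2.2
    exact ⟨⟨(a, b, c), Q.gcd_eq_one hd, hd⟩, h⟩
  have unique_pair {f P P'} (h : R f P) (h' : R f P') : stmt15PairsRel K P P' :=
    QuadraticCoords.IsFormOf.exists_eq_smul P.2.2 P'.2.2 h h'
  have unique_form {f f' P} (h : R f P) (h' : R f' P) : stmt15FormsRel D f f' := by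
    obtain ⟨p, q, r, t, hdet, ha, hb, hc⟩ := QuadraticCoords.IsFormOf.exists_matrix h h'
    refine ⟨⟨!![p, q; r, t], by rw [Matrix.det_fin_two_of, hdet]⟩, fun x y => ?_⟩
    simp [ha, hb, hc]
    ring
  have form_congr {f f' P} (hf : stmt15FormsRel D f f') (h : R f P) : R f' P := by
    obtain ⟨γ, hγ⟩ := hf
    have hdet := γ.2
    rw [Matrix.det_fin_two] at hdet
    have h10 := hγ 1 0
    have h01 := hγ 0 1
    have h11 := hγ 1 1
    simp only [R]
    convert QuadraticCoords.IsFormOf.of_matrix h hdet using 1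
    · linear_combination h10
    · linear_combination h11 - h10 - h01
    · linear_combination h01
  have pair_congr {f P P'} (hP : stmt15PairsRel K P P') (h : R f P') : R f P := by
    obtain ⟨x, hx, h1, h2⟩ := hP
    simp only [R]
    rw [h1, h2]
    exact QuadraticCoords.IsFormOf.smul h hx
  choose F hF using total
  choose G hG using surj
  refine ⟨⟨Quot.map F fun f f' h => ?_, Quot.map G fun P P' h => ?_, ?_, ?_⟩⟩
  · exact unique_pair (form_congr h (hF f)) (hF f')
  · exact unique_form (hG P) (pair_congr h (hG P'))
  · rintro ⟨f⟩
    exact Quot.sound (unique_form (hG (F f)) (hF f))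
  · rintro ⟨P⟩
    exact Quot.sound (unique_pair (hF (G P)) (hG P))
end
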